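/- Consider the Lindblad equation dρ/dt = β[a† - a, ρ] - ((κ+κ_c)/2)(Nρ + ρN - 2aρa†) - κ_c(aρa† - e^{iπN}aρa†e^{-iπN}) on finite-dimensional truncated matrices, with β, κ, κ_c > 0. If this equation admits a Hermitian positive definite equilibrium ρ_∞ of trace 1, then every trajectory with density-matrix initial condition converges to ρ_∞ (global asymptotic stability), since V(ρ) = Tr(ρ_∞G²) with ρ_∞G + Gρ_∞ = ρ - ρ_∞ is a strict Lyapunov function. -/

import Mathlib

open Matrix ComplexOrder Filter

attribute [local instance] Matrix.normedAddCommGroup Matrix.normedSpace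

/-- The truncated annihilation operator on `ℂ^{n+1}`: `a |k⟩ = √k |k-1⟩`. -/
noncomputable def ann (n : ℕ) : Matrix (Fin (n+1)) (Fin (n+1)) ℂ :=
  fun j k => if (j : ℕ) + 1 = (k : ℕ) then (Real.sqrt (k : ℕ) : ℂ) else 0

/-- The diagonal unitary `e^{iπN}` with entries `(-1)^k`. -/
def parity (n : ℕ) : Matrix (Fin (n+1)) (Fin (n+1)) ℂ :=
  Matrix.diagonal fun k => (-1 : ℂ) ^ (k : ℕ)

lemma aux_trace_pos {m : ℕ} {R : Matrix (Fin m) (Fin m) ℂ} (hR : R.PosDef)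
    (C : Matrix (Fin m) (Fin m) ℂ) (hC : C ≠ 0) : 0 < (C * R * Cᴴ).trace := by
  have h1 := hR.posSemidef.mul_mul_conjTranspose_same C
  refine lt_of_le_of_ne h1.trace_nonneg fun h => hC ?_
  have h2 : C * R * Cᴴ = 0 := h1.trace_eq_zero_iff.1 h.symm
  have h3 : Cᴴ = 0 := by
    apply Matrix.ext_of_mulVec_single
    intro i
    rw [Matrix.zero_mulVec]
    by_contra hx
    have := hR.dotProduct_mulVec_pos hx
    rw [star_mulVec, conjTranspose_conjTranspose, ← dotProduct_mulVec, mulVec_mulVec, mulVec_mulVec,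
      h2] at this
    simp at this
  simpa using h3

lemma aux_trace_nonneg {m : ℕ} {R : Matrix (Fin m) (Fin m) ℂ} (hR : R.PosDef)
    (C : Matrix (Fin m) (Fin m) ℂ) : 0 ≤ (C * R * Cᴴ).trace :=
  (hR.posSemidef.mul_mul_conjTranspose_same C).trace_nonneg

lemma aux_ham {m : ℕ} (X R G : Matrix (Fin m) (Fin m) ℂ) :
    (G * (X * (R * G + G * R) - (R * G + G * R) * X)).trace
      = (G * G * (X * R - R * X)).trace := by
  have e1 : (G * X * R * G).trace = (G * G * X * R).trace := by
    rw [trace_mul_comm]; simp only [mul_assoc]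
  have e2 : (G * R * G * X).trace = (G * X * G * R).trace := by
    rw [mul_assoc (G * R), trace_mul_comm]; simp only [mul_assoc]
  simp only [mul_add, add_mul, mul_sub, ← mul_assoc, trace_add, trace_sub]
  linear_combination e1 - e2

lemma aux_diss {m : ℕ} (L M R G : Matrix (Fin m) (Fin m) ℂ) :
    (G * ((2:ℂ) • (L * (R * G + G * R) * M)
        - (M * L * (R * G + G * R) + (R * G + G * R) * (M * L)))).trace
      = (G * G * ((2:ℂ) • (L * R * M) - (M * L * R + R * (M * L)))).trace
        - 2 * ((L * G - G * L) * R * (G * M - M * G)).trace := by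
  have e1 : (G * M * L * R * G).trace = (G * G * M * L * R).trace := by
    rw [trace_mul_comm]; simp only [mul_assoc]
  have e2 : (G * R * G * M * L).trace = (L * G * R * G * M).trace := by
    rw [trace_mul_comm]; simp only [mul_assoc]
  have e3 : (G * M * L * G * R).trace = (L * G * R * G * M).trace := by
    rw [show G * M * L * G * R = (G * M) * (L * G * R) by simp only [mul_assoc], trace_mul_comm]
    simp only [mul_assoc]
  have e4 : (L * G * R * M * G).trace = (G * L * G * R * M).trace := by
    rw [trace_mul_comm]; simp only [mul_assoc]
  have e5 : (G * L * R * M * G).trace = (G * G * L * R * M).trace := by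
    rw [trace_mul_comm]; simp only [mul_assoc]
  have e6 : (G * L * R * G * M).trace = (G * L * R * G * M).trace := rfl
  simp only [mul_add, add_mul, mul_sub, sub_mul, ← mul_assoc, trace_add, trace_sub, trace_smul,
    Matrix.mul_smul, smul_add, smul_eq_mul]
  linear_combination -e1 - e2 - e3 - 2 * e4 + 2 * e5

lemma aux_ann_mul {n : ℕ} (G : Matrix (Fin (n+1)) (Fin (n+1)) ℂ) (j : ℕ) (hj : j + 1 < n + 1)
    (k : Fin (n+1)) :
    (ann n * G) ⟨j, by omega⟩ k = (Real.sqrt ((j + 1 : ℕ) : ℝ) : ℂ) * G ⟨j+1, hj⟩ k := by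
  rw [mul_apply, Finset.sum_eq_single ⟨j+1, hj⟩]
  · simp [ann]
  · intro b _ hb
    have : ¬ (j + 1 = (b : ℕ)) := fun h => hb (Fin.ext h.symm)
    simp [ann, this]
  · simp

lemma aux_mul_ann {n : ℕ} (G : Matrix (Fin (n+1)) (Fin (n+1)) ℂ) (k : ℕ) (hk : k + 1 < n + 1)
    (j : Fin (n+1)) :
    (G * ann n) j ⟨k+1, hk⟩ = G j ⟨k, by omega⟩ * (Real.sqrt ((k + 1 : ℕ) : ℝ) : ℂ) := by
  rw [mul_apply, Finset.sum_eq_single ⟨k, by omega⟩]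
  · simp [ann]
  · intro b _ hb
    have : ¬ ((b : ℕ) = k) := fun h => hb (Fin.ext h)
    simp [ann, this]
  · simp

lemma aux_mul_ann_zero {n : ℕ} (G : Matrix (Fin (n+1)) (Fin (n+1)) ℂ) (j : Fin (n+1)) :
    (G * ann n) j ⟨0, by omega⟩ = 0 := by
  rw [mul_apply]
  apply Finset.sum_eq_zero
  intro b _
  simp [ann]

lemma aux_commutant {n : ℕ} (G : Matrix (Fin (n+1)) (Fin (n+1)) ℂ) (hG : Gᴴ = G)
    (h : ann n * G - G * ann n = 0) : ∃ c : ℂ, G = c • 1 := by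
  have hc : ann n * G = G * ann n := sub_eq_zero.1 h
  have hs : ∀ j : ℕ, (Real.sqrt ((j + 1 : ℕ) : ℝ) : ℂ) ≠ 0 := by
    intro j
    have : 0 < Real.sqrt ((j + 1 : ℕ) : ℝ) := Real.sqrt_pos.2 (by positivity)
    exact_mod_cast this.ne'
  have low : ∀ k (hk : k < n + 1) j (hj : j < n + 1), k < j → G ⟨j, hj⟩ ⟨k, hk⟩ = 0 := by
    intro k
    induction k with
    | zero =>
      intro hk j hj hkj
      obtain ⟨i, rfl⟩ : ∃ i, j = i + 1 := ⟨j - 1, by omega⟩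
      have := aux_ann_mul G i hj ⟨0, hk⟩
      rw [hc, aux_mul_ann_zero] at this
      exact (mul_eq_zero.1 this.symm).resolve_left (hs i)
    | succ k ih =>
      intro hk j hj hkj
      obtain ⟨i, rfl⟩ : ∃ i, j = i + 1 := ⟨j - 1, by omega⟩
      have := aux_ann_mul G i hj ⟨k+1, hk⟩
      rw [hc, aux_mul_ann G k hk, ih (by omega) i (by omega) (by omega), zero_mul] at this
      exact (mul_eq_zero.1 this.symm).resolve_left (hs i)
  have diag : ∀ k (hk : k < n + 1), G ⟨k, hk⟩ ⟨k, hk⟩ = G 0 0 := by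
    intro k
    induction k with
    | zero => intro hk; rfl
    | succ k ih =>
      intro hk
      have := aux_ann_mul G k hk ⟨k+1, hk⟩
      rw [hc, aux_mul_ann G k hk, ih, mul_comm] at this
      exact (mul_left_cancel₀ (hs k) this).symm
  refine ⟨G 0 0, ?_⟩
  ext ⟨j, hj⟩ ⟨k, hk⟩
  rcases lt_trichotomy j k with hjk | hjk | hjk
  · have h0 := low j hj k hk hjk
    rw [← hG, conjTranspose_apply, h0]
    simp [one_apply, hjk.ne]
  · subst hjk
    simp [diag j hj]
  · rw [low k hk j hj hjk]
    simp [one_apply, hjk.ne']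

lemma aux_compact {E : Type*} [NormedAddCommGroup E] [NormedSpace ℝ E] [FiniteDimensional ℝ E]
    (U : Submodule ℝ E) (f g : E → ℝ) (hf : Continuous f) (hg : Continuous g)
    (hf2 : ∀ (r : ℝ) x, f (r • x) = r ^ 2 * f x) (hg2 : ∀ (r : ℝ) x, g (r • x) = r ^ 2 * g x)
    (hpos : ∀ x ∈ U, x ≠ 0 → 0 < f x) : ∃ c > 0, ∀ x ∈ U, c * g x ≤ f x := by
  have : ProperSpace E := FiniteDimensional.proper ℝ E
  have hK : IsCompact (Metric.sphere (0:E) 1 ∩ (U : Set E)) :=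
    (isCompact_sphere 0 1).inter_right U.closed_of_finiteDimensional
  have hfK : ∀ x ∈ Metric.sphere (0:E) 1 ∩ (U : Set E), 0 < f x := by
    rintro x ⟨hx, hxU⟩
    exact hpos x hxU (by rintro rfl; simp at hx)
  have hz : ∀ h : E → ℝ, (∀ (r : ℝ) x, h (r • x) = r ^ 2 * h x) → h 0 = 0 := by
    intro h hh
    simpa using hh 0 0
  obtain ⟨C, hC⟩ := (hK.image_of_continuousOn
    (f := fun x => g x / f x)
    (hg.continuousOn.div hf.continuousOn fun x hx => (hfK x hx).ne')).bddAbove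
  have hC' : ∀ x ∈ Metric.sphere (0:E) 1 ∩ (U : Set E), g x ≤ (|C| + 1) * f x := by
    intro x hx
    have h1 : g x / f x ≤ C := hC ⟨x, hx, rfl⟩
    rw [div_le_iff₀ (hfK x hx)] at h1
    nlinarith [hfK x hx, le_abs_self C]
  refine ⟨(|C| + 1)⁻¹, by positivity, fun x hx => ?_⟩
  rw [inv_mul_le_iff₀ (by positivity)]
  by_cases hx0 : x = 0
  · subst hx0; simp [hz f hf2, hz g hg2]
  have hn : 0 < ‖x‖ := norm_pos_iff.2 hx0
  have h1 := hC' (‖x‖⁻¹ • x) ⟨by simp [norm_smul, hn.ne'], U.smul_mem _ hx⟩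
  rw [hf2, hg2] at h1
  have h2 : 0 < (‖x‖⁻¹) ^ 2 := by positivity
  have h3 : (‖x‖⁻¹) ^ 2 * g x ≤ (‖x‖⁻¹) ^ 2 * ((|C| + 1) * f x) := by linarith
  exact le_of_mul_le_mul_left h3 h2

lemma aux_lyap {E : Type*} [NormedAddCommGroup E] [NormedSpace ℝ E] [FiniteDimensional ℝ E]
    (U : Submodule ℝ E) (V W : E → ℝ) (hV : Continuous V) (hW : Continuous W)
    (hV2 : ∀ (r : ℝ) x, V (r • x) = r ^ 2 * V x) (hW2 : ∀ (r : ℝ) x, W (r • x) = r ^ 2 * W x)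
    (hVp : ∀ x ∈ U, x ≠ 0 → 0 < V x) (hWp : ∀ x ∈ U, x ≠ 0 → 0 < W x)
    (G : ℝ → E) (hGU : ∀ t, G t ∈ U) (V' : ℝ → ℝ) (hd : ∀ t, HasDerivAt (fun t => V (G t)) (V' t) t)
    (hle : ∀ t, V' t ≤ - W (G t)) : Tendsto G atTop (nhds 0) := by
  obtain ⟨c, hc, hcW⟩ := aux_compact U W V hW hV hW2 hV2 hWp
  obtain ⟨d, hd0, hdV⟩ := aux_compact U V (fun x => ‖x‖ ^ 2) hV (by fun_prop) hV2
    (by intro r x; simp [norm_smul, mul_pow]) hVp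
  have hder : ∀ t, HasDerivAt (fun t => Real.exp (c * t) * V (G t))
      (Real.exp (c * t) * (c * 1) * V (G t) + Real.exp (c * t) * V' t) t := fun t =>
    (((hasDerivAt_id t).const_mul c).exp).mul (hd t)
  have hanti : Antitone (fun t => Real.exp (c * t) * V (G t)) := by
    apply antitone_of_deriv_nonpos (fun t => (hder t).differentiableAt)
    intro t
    rw [(hder t).deriv]
    have h1 := hcW _ (hGU t)
    have h2 := hle t
    have h3 := Real.exp_pos (c * t)
    have h4 : Real.exp (c * t) * (c * V (G t) + V' t) ≤ 0 :=
      mul_nonpos_of_nonneg_of_nonpos h3.le (by linarith)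
    linarith
  have hbound : ∀ t, 0 ≤ t → ‖G t‖ ^ 2 ≤ d⁻¹ * (Real.exp (-(c * t)) * V (G 0)) := by
    intro t ht
    have h1 := hanti ht
    have h2 := hdV _ (hGU t)
    simp only [mul_zero, Real.exp_zero, one_mul] at h1
    rw [le_inv_mul_iff₀ hd0, Real.exp_neg, le_inv_mul_iff₀ (Real.exp_pos _)]
    exact le_trans (mul_le_mul_of_nonneg_left h2 (Real.exp_pos _).le) h1
  have hlim : Tendsto (fun t : ℝ => d⁻¹ * (Real.exp (-(c * t)) * V (G 0))) atTop (nhds 0) := by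
    have h1 : Tendsto (fun t : ℝ => Real.exp (-(c * t))) atTop (nhds 0) :=
      Real.tendsto_exp_neg_atTop_nhds_zero.comp (tendsto_id.const_mul_atTop hc)
    simpa using (h1.mul_const (V (G 0))).const_mul d⁻¹
  have hsq : Tendsto (fun t => ‖G t‖ ^ 2) atTop (nhds 0) := by
    refine tendsto_of_tendsto_of_tendsto_of_le_of_le' tendsto_const_nhds hlim
      (Eventually.of_forall fun t => by positivity) ?_
    filter_upwards [eventually_ge_atTop 0] with t ht using hbound t ht
  rw [tendsto_zero_iff_norm_tendsto_zero]
  have := hsq.sqrt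
  simpa using this

lemma aux_deriv_lin {E F : Type*} [NormedAddCommGroup E] [NormedSpace ℝ E] [FiniteDimensional ℝ E]
    [NormedAddCommGroup F] [NormedSpace ℝ F] (f : E →ₗ[ℝ] F) {u : ℝ → E} {u' : E} {t : ℝ}
    (h : HasDerivAt u u' t) : HasDerivAt (fun t => f (u t)) (f u') t :=
  (LinearMap.toContinuousLinearMap f).hasFDerivAt.comp_hasDerivAt t h

lemma aux_unique {E : Type*} [NormedAddCommGroup E] [NormedSpace ℝ E] [FiniteDimensional ℝ E]
    (L : E →ₗ[ℝ] E) (f g : ℝ → E) (hf : ∀ t, HasDerivAt f (L (f t)) t)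
    (hg : ∀ t, HasDerivAt g (L (g t)) t) (h0 : f 0 = g 0) : f = g :=
  ODE_solution_unique_univ (v := fun _ => LinearMap.toContinuousLinearMap L)
    (s := fun _ => Set.univ) (K := ‖LinearMap.toContinuousLinearMap L‖₊) (t₀ := 0)
    (fun _ => (LinearMap.toContinuousLinearMap L).lipschitz.lipschitzOnWith)
    (fun t => ⟨hf t, trivial⟩) (fun t => ⟨hg t, trivial⟩) h0

lemma aux_deriv_bilin {E : Type*} [NormedAddCommGroup E] [NormedSpace ℝ E] [FiniteDimensional ℝ E]
    (B : E →ₗ[ℝ] E →ₗ[ℝ] ℝ) {u : ℝ → E} {u' : E} {t : ℝ}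
    (h : HasDerivAt u u' t) : HasDerivAt (fun t => B (u t) (u t)) (B (u t) u' + B u' (u t)) t :=
  (B.toContinuousBilinearMap).hasDerivAt_of_bilinear (fun _ => h) (fun _ => h)

lemma aux_lop_form {n : ℕ} (κ κc : ℝ) (σ : Matrix (Fin (n+1)) (Fin (n+1)) ℂ) :
      - (((κ + κc)/2 : ℝ) : ℂ) • (((ann n)ᴴ * ann n) * σ + σ * ((ann n)ᴴ * ann n)
          - (2:ℂ) • (ann n * σ * (ann n)ᴴ))
      - (κc : ℂ) • (ann n * σ * (ann n)ᴴ
          - parity n * (ann n * σ * (ann n)ᴴ) * (parity n)ᴴ) =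
      ((κ/2 : ℝ) : ℂ) • ((2:ℂ) • (ann n * σ * (ann n)ᴴ)
        - ((ann n)ᴴ * ann n * σ + σ * ((ann n)ᴴ * ann n)))
      + ((κc/2 : ℝ) : ℂ) • ((2:ℂ) • ((parity n * ann n) * σ * (parity n * ann n)ᴴ)
        - ((parity n * ann n)ᴴ * (parity n * ann n) * σ
          + σ * ((parity n * ann n)ᴴ * (parity n * ann n)))) := by
  have hP : (parity n)ᴴ * parity n = 1 := by
    simp only [parity, diagonal_conjTranspose, diagonal_mul_diagonal]
    rw [← diagonal_one]
    congr 1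
    ext k
    simp [← mul_pow]
  have h1 : (parity n * ann n)ᴴ * (parity n * ann n) = (ann n)ᴴ * ann n := by
    rw [conjTranspose_mul, mul_assoc, ← mul_assoc _ (parity n), hP, one_mul]
  have h2 : (parity n * ann n) * σ * (parity n * ann n)ᴴ
      = parity n * (ann n * σ * (ann n)ᴴ) * (parity n)ᴴ := by
    rw [conjTranspose_mul]; simp only [mul_assoc]
  rw [h1, h2]
  push_cast
  module

theorem aux_main {n : ℕ} (β κ κc : ℝ)
    (hβ : 0 < β) (hκ : 0 < κ) (hκc : 0 < κc)
    (Lop : Matrix (Fin (n+1)) (Fin (n+1)) ℂ → Matrix (Fin (n+1)) (Fin (n+1)) ℂ)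
    (hLop0 : ∀ σ, Lop σ =
      (β : ℂ) • (((ann n)ᴴ - ann n) * σ - σ * ((ann n)ᴴ - ann n))
      - (((κ + κc)/2 : ℝ) : ℂ) • (((ann n)ᴴ * ann n) * σ + σ * ((ann n)ᴴ * ann n)
          - (2:ℂ) • (ann n * σ * (ann n)ᴴ))
      - (κc : ℂ) • (ann n * σ * (ann n)ᴴ
          - parity n * (ann n * σ * (ann n)ᴴ) * (parity n)ᴴ))
    (R : Matrix (Fin (n+1)) (Fin (n+1)) ℂ)
    (hR : R.PosDef) (htrR : R.trace = 1) (heq : Lop R = 0)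
    (ρ : ℝ → Matrix (Fin (n+1)) (Fin (n+1)) ℂ)
    (hρode : ∀ t, HasDerivAt ρ (Lop (ρ t)) t)
    (hρ0 : (ρ 0).PosSemidef) (htr0 : (ρ 0).trace = 1) :
    Tendsto ρ atTop (nhds R) := by
  obtain ⟨A, hA⟩ : ∃ A, A = ann n := ⟨_, rfl⟩
  obtain ⟨Q, hQ⟩ : ∃ Q, Q = parity n * ann n := ⟨_, rfl⟩
  have hLop : ∀ σ, Lop σ = (β : ℂ) • ((Aᴴ - A) * σ - σ * (Aᴴ - A))
      + ((κ/2 : ℝ) : ℂ) • ((2:ℂ) • (A * σ * Aᴴ) - (Aᴴ * A * σ + σ * (Aᴴ * A)))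
      + ((κc/2 : ℝ) : ℂ) • ((2:ℂ) • (Q * σ * Qᴴ) - (Qᴴ * Q * σ + σ * (Qᴴ * Q))) := by
    intro σ
    rw [hLop0, hA, hQ, add_assoc, ← aux_lop_form]
    module
  clear hLop0
  -- linearity
  have hadd : ∀ x y, Lop (x + y) = Lop x + Lop y := by
    intro x y
    simp only [hLop, mul_add, add_mul]
    module
  have hsmul : ∀ (r : ℝ) x, Lop (r • x) = r • Lop x := by
    intro r x
    simp only [hLop, Matrix.mul_smul, Matrix.smul_mul, ← Complex.coe_smul]
    module
  let L : Matrix (Fin (n+1)) (Fin (n+1)) ℂ →ₗ[ℝ] Matrix (Fin (n+1)) (Fin (n+1)) ℂ :=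
    { toFun := Lop, map_add' := hadd, map_smul' := hsmul }
  have hL : ∀ x, L x = Lop x := fun _ => rfl
  have hstar : ∀ x, Lop xᴴ = (Lop x)ᴴ := by
    intro x
    simp only [hLop, conjTranspose_add, conjTranspose_sub, conjTranspose_smul, conjTranspose_mul,
      conjTranspose_conjTranspose, RCLike.star_def, Complex.conj_ofReal, map_ofNat, sub_mul, mul_sub,
      ← mul_assoc]
    module
  have htrL : ∀ x, (Lop x).trace = 0 := by
    intro x
    have e1 : ∀ M : Matrix (Fin (n+1)) (Fin (n+1)) ℂ, (M * x * Mᴴ).trace = (Mᴴ * M * x).trace := by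
      intro M; rw [trace_mul_comm]; simp only [mul_assoc]
    have e2 : ∀ M : Matrix (Fin (n+1)) (Fin (n+1)) ℂ, (x * M).trace = (M * x).trace :=
      fun M => trace_mul_comm _ _
    rw [hLop]
    simp only [trace_add, trace_sub, trace_smul, e1, e2, smul_eq_mul]
    ring
  -- hermiticity
  let star' : Matrix (Fin (n+1)) (Fin (n+1)) ℂ →ₗ[ℝ] Matrix (Fin (n+1)) (Fin (n+1)) ℂ :=
    { toFun := fun x => xᴴ, map_add' := conjTranspose_add,
      map_smul' := fun r x => by simp [conjTranspose_smul] }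
  have hherm : ∀ t, (ρ t)ᴴ = ρ t := by
    have h := aux_unique L (fun t => (ρ t)ᴴ) ρ (fun t => by
        have := aux_deriv_lin star' (hρode t)
        have h2 : star' (Lop (ρ t)) = Lop (ρ t)ᴴ := (hstar _).symm
        rw [h2] at this
        exact this) hρode hρ0.isHermitian
    exact fun t => congrFun h t
  -- trace
  let tr : Matrix (Fin (n+1)) (Fin (n+1)) ℂ →ₗ[ℝ] ℂ :=
    { toFun := fun x => x.trace, map_add' := trace_add,
      map_smul' := fun r x => by simp [trace_smul] }
  have htr : ∀ t, (ρ t).trace = 1 := by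
    have hd : ∀ t, HasDerivAt (fun t => (ρ t).trace) 0 t := by
      intro t
      have := aux_deriv_lin tr (hρode t)
      have h2 : tr (Lop (ρ t)) = 0 := htrL _
      rw [h2] at this
      exact this
    intro t
    rw [← htr0]
    exact is_const_of_deriv_eq_zero (fun t => (hd t).differentiableAt) (fun t => (hd t).deriv) t 0
  -- the Sylvester operator
  let S : Matrix (Fin (n+1)) (Fin (n+1)) ℂ →ₗ[ℝ] Matrix (Fin (n+1)) (Fin (n+1)) ℂ :=
    { toFun := fun x => R * x + x * R
      map_add' := fun x y => by simp only [mul_add, add_mul]; abel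
      map_smul' := fun r x => by simp }
  have hS : ∀ x, S x = R * x + x * R := fun _ => rfl
  have hSinj : Function.Injective S := by
    rw [injective_iff_map_eq_zero]
    intro x hx
    by_contra hx0
    have h1 := aux_trace_pos hR xᴴ (by simpa using hx0)
    have h2 := aux_trace_nonneg hR x
    rw [conjTranspose_conjTranspose] at h1
    have h3 : (xᴴ * S x).trace = (xᴴ * R * x).trace + (x * R * xᴴ).trace := by
      rw [hS, mul_add, trace_add, ← mul_assoc, trace_mul_comm (x * R)]
    rw [hx] at h3
    have := add_pos_of_pos_of_nonneg h1 h2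
    rw [← h3] at this
    simp at this
  let T := (LinearEquiv.ofInjectiveEndo S hSinj)
  have hT : ∀ x, S (T.symm x) = x := fun x => T.apply_symm_apply x
  obtain ⟨G, hG⟩ : ∃ G : ℝ → Matrix (Fin (n+1)) (Fin (n+1)) ℂ,
    G = fun t => T.symm (ρ t - R) := ⟨_, rfl⟩
  have hSG : ∀ t, S (G t) = ρ t - R := by intro t; rw [hG]; exact hT _
  have hGd : ∀ t, HasDerivAt G (T.symm (Lop (S (G t)))) t := by
    intro t
    have h1 : HasDerivAt (fun t => ρ t - R) (Lop (ρ t)) t := (hρode t).sub_const R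
    have h2 := aux_deriv_lin T.symm.toLinearMap h1
    have h3 : Lop (S (G t)) = Lop (ρ t) := by
      rw [hSG, ← hL, map_sub, hL, hL, heq, sub_zero]
    rw [h3, hG]
    exact h2
  have hRh : Rᴴ = R := hR.isHermitian
  have hGh : ∀ t, (G t)ᴴ = G t := by
    intro t
    apply hSinj
    have : S (G t)ᴴ = (S (G t))ᴴ := by
      simp only [hS, conjTranspose_add, conjTranspose_mul, hRh]
      abel
    rw [this, hSG, conjTranspose_sub, hherm, hRh]
  have hGt : ∀ t, (R * G t).trace = 0 := by
    intro t
    have h := congrArg Matrix.trace (hSG t)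
    rw [hS, trace_add, trace_mul_comm (G t), trace_sub, htr, htrR, sub_self] at h
    linear_combination h / 2
  let U : Submodule ℝ (Matrix (Fin (n+1)) (Fin (n+1)) ℂ) :=
    { carrier := {x | xᴴ = x ∧ (R * x).trace = 0}
      add_mem' := by
        rintro x y ⟨hx, hx'⟩ ⟨hy, hy'⟩
        exact ⟨by rw [conjTranspose_add, hx, hy], by rw [mul_add, trace_add, hx', hy', add_zero]⟩
      zero_mem' := by simp
      smul_mem' := by
        rintro r x ⟨hx, hx'⟩
        exact ⟨by rw [conjTranspose_smul, hx]; simp,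
          by rw [Matrix.mul_smul, trace_smul, hx', smul_zero]⟩ }
  have hGU : ∀ t, G t ∈ U := fun t => ⟨hGh t, hGt t⟩
  -- bilinear form for V
  let B : Matrix (Fin (n+1)) (Fin (n+1)) ℂ →ₗ[ℝ] Matrix (Fin (n+1)) (Fin (n+1)) ℂ →ₗ[ℝ] ℝ :=
    LinearMap.mk₂ ℝ (fun x y => (R * x * y).trace.re)
      (fun x y z => by simp [mul_add, add_mul])
      (fun r x y => by simp)
      (fun x y z => by simp [mul_add])
      (fun r x y => by simp)
  have hB : ∀ x y, B x y = (R * x * y).trace.re := fun _ _ => rfl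
  have hVd : ∀ t, HasDerivAt (fun t => B (G t) (G t)) ((G t * Lop (S (G t))).trace.re) t := by
    intro t
    have h := aux_deriv_bilin B (hGd t)
    convert h using 1
    have h1 := hT (Lop (S (G t)))
    rw [hS] at h1
    conv_lhs => rw [← h1]
    rw [hB, hB, ← Complex.add_re, mul_add, trace_add, add_comm, ← mul_assoc,
      trace_mul_comm _ R, ← mul_assoc, trace_mul_comm (G t) (R * _)]
  let C : Matrix (Fin (n+1)) (Fin (n+1)) ℂ → Matrix (Fin (n+1)) (Fin (n+1)) ℂ :=
    fun x => A * x - x * A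
  have hlim : Tendsto G atTop (nhds 0) := by
    refine aux_lyap U (fun x => B x x) (fun x => κ * ((C x) * R * (C x)ᴴ).trace.re) ?_ ?_ ?_ ?_ ?_ ?_
      G hGU _ hVd ?_
    · simp only [hB]; fun_prop
    · simp only [C]; fun_prop
    · intro r x
      simp only [map_smul, LinearMap.smul_apply, smul_eq_mul]; ring
    · intro r x
      have : C (r • x) = r • C x := by simp [C, smul_sub]
      simp only [this, conjTranspose_smul, Matrix.smul_mul, Matrix.mul_smul, trace_smul,
        Complex.smul_re, star_trivial, smul_eq_mul]
      ring
    · rintro x ⟨hx, -⟩ hx0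
      have := aux_trace_pos hR x hx0
      rw [hx, trace_mul_comm, ← mul_assoc, trace_mul_comm, ← mul_assoc] at this
      exact (Complex.pos_iff.1 this).1
    · rintro x ⟨hx, hx'⟩ hx0
      have hC : C x ≠ 0 := by
        intro h
        obtain ⟨c, rfl⟩ := aux_commutant x hx (by rw [← hA]; exact h)
        apply hx0
        simp [htrR] at hx'
        simp [hx']
      have := aux_trace_pos hR _ hC
      exact mul_pos hκ (Complex.pos_iff.1 this).1
    · intro t
      obtain ⟨g, hg⟩ : ∃ g, g = G t := ⟨_, rfl⟩
      have hgh : gᴴ = g := by rw [hg]; exact hGh t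
      rw [← hg]
      have hc : ∀ M : Matrix (Fin (n+1)) (Fin (n+1)) ℂ,
          (M * g - g * M)ᴴ = g * Mᴴ - Mᴴ * g := by
        intro M; rw [conjTranspose_sub, conjTranspose_mul, conjTranspose_mul, hgh]
      have key : (g * Lop (S g)).trace = (g * g * Lop R).trace
          - (κ : ℂ) * ((A * g - g * A) * R * (A * g - g * A)ᴴ).trace
          - (κc : ℂ) * ((Q * g - g * Q) * R * (Q * g - g * Q)ᴴ).trace := by
        have e0 := aux_ham (Aᴴ - A) R g
        have e1 := aux_diss A Aᴴ R g
        have e2 := aux_diss Q Qᴴ R g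
        rw [hS, hLop, hLop, hc, hc]
        have ex : ∀ (M a b c : Matrix (Fin (n+1)) (Fin (n+1)) ℂ) (x y z : ℂ),
            (M * (x • a + y • b + z • c)).trace
              = x * (M * a).trace + y * (M * b).trace + z * (M * c).trace := by
          intro M a b c x y z
          simp only [mul_add, Matrix.mul_smul, trace_add, trace_smul, smul_eq_mul]
        rw [ex, ex, e0, e1, e2]
        push_cast
        ring
      rw [key, heq]
      have p := (Complex.nonneg_iff.1 (aux_trace_nonneg hR (Q * g - g * Q))).1
      have p2 := mul_nonneg hκc.le p
      simp only [C, mul_zero, trace_zero, Complex.sub_re, Complex.re_ofReal_mul, Complex.zero_re]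
      linarith
  have hfin : Tendsto (fun t => S (G t) + R) atTop (nhds (S 0 + R)) :=
    (((LinearMap.toContinuousLinearMap S).continuous.tendsto 0).comp hlim).add_const R
  rw [map_zero, zero_add] at hfin
  refine hfin.congr fun t => ?_
  rw [hSG]; abel

/-- Global asymptotic stability of the cat-state reservoir Lindblad equation
`dρ/dt = β[a†-a,ρ] - ((κ+κ_c)/2)(Nρ+ρN-2aρa†) - κ_c(aρa† - e^{iπN}aρa†e^{-iπN})`:
if it admits a full-rank trace-1 equilibrium `ρinf`, every trajectory starting
from a density matrix converges to `ρinf`. -/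
theorem cat_reservoir_global_convergence {n : ℕ} (β κ κc : ℝ)
    (hβ : 0 < β) (hκ : 0 < κ) (hκc : 0 < κc)
    (Lop : Matrix (Fin (n+1)) (Fin (n+1)) ℂ → Matrix (Fin (n+1)) (Fin (n+1)) ℂ)
    (hLop : ∀ σ, Lop σ =
      (β : ℂ) • (((ann n)ᴴ - ann n) * σ - σ * ((ann n)ᴴ - ann n))
      - (((κ + κc)/2 : ℝ) : ℂ) • (((ann n)ᴴ * ann n) * σ + σ * ((ann n)ᴴ * ann n)
          - (2:ℂ) • (ann n * σ * (ann n)ᴴ))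
      - (κc : ℂ) • (ann n * σ * (ann n)ᴴ
          - parity n * (ann n * σ * (ann n)ᴴ) * (parity n)ᴴ))
    (ρinf : Matrix (Fin (n+1)) (Fin (n+1)) ℂ)
    (hρinf : ρinf.PosDef) (htrinf : ρinf.trace = 1) (heq : Lop ρinf = 0)
    (ρ : ℝ → Matrix (Fin (n+1)) (Fin (n+1)) ℂ)
    (hρode : ∀ t, HasDerivAt ρ (Lop (ρ t)) t)
    (hρ0 : (ρ 0).PosSemidef) (htr0 : (ρ 0).trace = 1) :
    Tendsto ρ atTop (nhds ρinf) := by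
  exact aux_main β κ κc hβ hκ hκc Lop hLop ρinf hρinf htrinf heq ρ hρode hρ0 htr0
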